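/- Let X be a nonempty set, let d : X² → ℝ be a pseudometric on X, and let d̃ : Y² → ℝ be the metric identification of d, where Y = X/≎₀ is the quotient set of X with respect to ≎₀. Then the semigroups B_X(P_{d⁻¹}) and B_Y(P_{d̃⁻¹}) are isomorphic. -/

import Mathlib

open Set

universe u v w z

def range2 {X : Type u} {A : Type w} (Φ : X → X → A) : Set A := {a | ∃ x y, Φ x y = a}

def fiber {X : Type u} {A : Type w} (Φ : X → X → A) (a : A) : Set (X × X) :=
  {p | Φ p.1 p.2 = a}

def fibers {X : Type u} {A : Type w} (Φ : X → X → A) : Set (Set (X × X)) :=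
  {R | ∃ a ∈ range2 Φ, R = fiber Φ a}

def IsCoherent {X : Type u} {A : Type w} (Φ : X → X → A) (a₀ : A) : Prop :=
  Equivalence (fun x y => Φ x y = a₀) ∧
    ∀ x₁ x₂ x₃ x₄, Φ x₁ x₂ = a₀ → Φ x₃ x₄ = a₀ → Φ x₁ x₃ = Φ x₂ x₄

def CombSim {X : Type u} {Y : Type v} {A : Type w} {B : Type z}
    (Φ : X → X → A) (Ψ : Y → Y → B) : Prop :=
  ∃ (g : Y → X) (f : A → B), Function.Bijective g ∧
    Set.BijOn f (range2 Φ) (range2 Ψ) ∧ ∀ x y, Ψ x y = f (Φ (g x) (g y))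

def IsPseudometric {X : Type u} (d : X → X → ℝ) : Prop :=
  (∀ x y, 0 ≤ d x y) ∧ (∀ x y, d x y = d y x) ∧ (∀ x, d x x = 0) ∧
    ∀ x y z, d x y ≤ d x z + d z y

noncomputable instance relSemigroup {X : Type u} : Semigroup (Set (X × X)) where
  mul R T := {p : X × X | ∃ zz, (p.1, zz) ∈ R ∧ (zz, p.2) ∈ T}
  mul_assoc R S T := by
    ext p
    constructor
    · rintro ⟨a, ⟨b, h1, h2⟩, h3⟩
      exact ⟨b, h1, a, h2, h3⟩
    · rintro ⟨b, h1, a, h2, h3⟩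
      exact ⟨a, ⟨b, h1, h2⟩, h3⟩

/-- Taking preimages along a surjection is a homomorphism of semigroups of binary relations. -/
def relComap {X : Type u} {Y : Type v} (π : X → Y) (hπ : Function.Surjective π) :
    Set (Y × Y) →ₙ* Set (X × X) where
  toFun R := Prod.map π π ⁻¹' R
  map_mul' R T := by
    ext p
    constructor
    · rintro ⟨y, h₁, h₂⟩
      obtain ⟨x, rfl⟩ := hπ y
      exact ⟨x, h₁, h₂⟩
    · rintro ⟨x, h₁, h₂⟩
      exact ⟨π x, h₁, h₂⟩

theorem relComap_injective {X : Type u} {Y : Type v} (π : X → Y)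
    (hπ : Function.Surjective π) : Function.Injective (relComap π hπ) :=
  (hπ.prodMap hπ).preimage_injective

theorem range2_eq_of_surjective {X : Type u} {Y : Type v} {A : Type w} {π : X → Y}
    (hπ : Function.Surjective π) {Φ : X → X → A} {Ψ : Y → Y → A}
    (h : ∀ x y, Ψ (π x) (π y) = Φ x y) : range2 Φ = range2 Ψ := by
  ext a
  simp only [range2, mem_ofPred_eq, hπ.exists, h]

theorem relComap_fiber {X : Type u} {Y : Type v} {A : Type w} {π : X → Y}
    (hπ : Function.Surjective π) {Φ : X → X → A} {Ψ : Y → Y → A}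
    (h : ∀ x y, Ψ (π x) (π y) = Φ x y) (a : A) :
    relComap π hπ (fiber Ψ a) = fiber Φ a := by
  ext p
  change Ψ (π p.1) (π p.2) = a ↔ Φ p.1 p.2 = a
  rw [h]

theorem relComap_image_fibers {X : Type u} {Y : Type v} {A : Type w} {π : X → Y}
    (hπ : Function.Surjective π) {Φ : X → X → A} {Ψ : Y → Y → A}
    (h : ∀ x y, Ψ (π x) (π y) = Φ x y) : relComap π hπ '' fibers Ψ = fibers Φ := by
  ext R
  constructor
  · rintro ⟨_, ⟨a, ha, rfl⟩, rfl⟩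
    exact ⟨a, range2_eq_of_surjective hπ h ▸ ha, relComap_fiber hπ h a⟩
  · rintro ⟨a, ha, rfl⟩
    exact ⟨_, ⟨a, range2_eq_of_surjective hπ h ▸ ha, rfl⟩, relComap_fiber hπ h a⟩

/-- Proposition 4.16: let `d` be a pseudometric on a nonempty set `X`, let
`Y = X/≎₀` be the quotient of `X` by the relation `d(x,y) = 0`, and let `d̃` be the
metric identification of `d` (i.e. `d̃(⟦x⟧,⟦y⟧) = d(x,y)`). Then the semigroups
`B_X(P_{d⁻¹})` and `B_Y(P_{d̃⁻¹})` are isomorphic. -/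
theorem metric_identification_fiber_semigroups_isomorphic {X : Type u} [Nonempty X]
    (d : X → X → ℝ) (hd : IsPseudometric d)
    (dt : Quot (fun x y => d x y = 0) → Quot (fun x y => d x y = 0) → ℝ)
    (hdt : ∀ x y, dt (Quot.mk _ x) (Quot.mk _ y) = d x y) :
    Nonempty ((Subsemigroup.closure (fibers d)) ≃* (Subsemigroup.closure (fibers dt))) := by
  have hπ : Function.Surjective (Quot.mk (fun x y => d x y = 0)) := Quot.mk_surjective
  have hmap : (Subsemigroup.closure (fibers dt)).map (relComap _ hπ) =
      Subsemigroup.closure (fibers d) := by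
    rw [MulHom.map_mclosure, relComap_image_fibers hπ hdt]
  rw [← hmap]
  exact ⟨((Subsemigroup.closure (fibers dt)).equivMapOfInjective _
    (relComap_injective _ hπ)).symm⟩
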